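/- Fix e > 0, and a continuous strictly monotone function f on (0,∞). Let CC : (0,1] → (0,∞) be continuous strictly increasing with CC(pq) = e·CC(p)·CC(q) for all p, q ∈ (0,1]. For each n ≥ 1, U ∈ Δ_n, P ∈ Δ_n⁺ define C(U; P) = f⁻¹( Σ_{k=1}^n u_k·f(CC(p_k)) ), and assume C(U⋆V; P⋆Q) = e·C(U; P)·C(V; Q) for all n, m, U ∈ Δ_n, V ∈ Δ_m, P ∈ Δ_n⁺, Q ∈ Δ_m⁺. Then there exist τ < 0 and c with c·e > 0 such that either C(U; P) = (1/e)·2^{ −c·τ·Σ_k u_k·log₂ p_k } for all n, U, P, or there exists λ ≠ 0 with C(U; P) = (1/e)·( Σ_k u_k·p_k^{τλ} )^{−c/λ} for all n, U, P. -/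

import Mathlib

open Set

/-- `p` is a probability distribution on `Fin n`. -/
def IsDist {n : ℕ} (p : Fin n → ℝ) : Prop := (∀ i, 0 ≤ p i) ∧ ∑ i, p i = 1

/-- `p` is a strictly positive probability distribution on `Fin n`. -/
def IsPosDist {n : ℕ} (p : Fin n → ℝ) : Prop := (∀ i, 0 < p i) ∧ ∑ i, p i = 1

/-- The direct product `P ⋆ Q` of two distributions, reindexed over `Fin (n*m)`. -/
noncomputable def prodDist {n m : ℕ} (p : Fin n → ℝ) (q : Fin m → ℝ) :
    Fin (n * m) → ℝ :=
  fun i => p (finProdFinEquiv.symm i).1 * q (finProdFinEquiv.symm i).2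

theorem cauchy_half (k : ℝ → ℝ) (hc : ContinuousOn k (Ici 0))
    (ha : ∀ x, 0 ≤ x → ∀ y, 0 ≤ y → k (x + y) = k x + k y) :
    ∃ c : ℝ, ∀ x, 0 ≤ x → k x = c * x := by
  have hcm : ∀ g : ℝ → ℝ, Continuous g → (∀ x, 0 ≤ g x) → Continuous fun x => k (g x) := by
    intro g hg h0
    exact hc.comp_continuous hg h0
  have h1 : Continuous fun x : ℝ => k (max x 0) - k (max (-x) 0) :=
    (hcm _ (by fun_prop) (fun x => le_max_right _ _)).sub
      (hcm _ (by fun_prop) (fun x => le_max_right _ _))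
  have k0 : k 0 = 0 := by have := ha 0 le_rfl 0 le_rfl; simp at this; exact this
  have hpm : ∀ x : ℝ, max x 0 - max (-x) 0 = x := by
    intro x
    rcases le_total x 0 with h | h
    · rw [max_eq_right h, max_eq_left (by linarith)]; ring
    · rw [max_eq_left h, max_eq_right (by linarith)]; ring
  let K : ℝ →+ ℝ := AddMonoidHom.mk' (fun x => k (max x 0) - k (max (-x) 0)) (by
    intro x y
    have e1 : max (x + y) 0 + (max (-x) 0 + max (-y) 0)
        = max (-(x+y)) 0 + (max x 0 + max y 0) := by
      linarith [hpm x, hpm y, hpm (x+y)]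
    have p : ∀ z : ℝ, 0 ≤ max z 0 := fun z => le_max_right _ _
    have e2 := congrArg k e1
    rw [ha _ (p _) _ (add_nonneg (p _) (p _)), ha _ (p _) _ (add_nonneg (p _) (p _)),
      ha _ (p _) _ (p _), ha _ (p _) _ (p _)] at e2
    linarith)
  refine ⟨K 1, fun x hx => ?_⟩
  have h2 := map_real_smul K h1 x 1
  have h3 : K x = k x := by
    change k (max x 0) - k (max (-x) 0) = k x
    rw [max_eq_left hx, max_eq_right (by linarith), k0, sub_zero]
  simp only [smul_eq_mul, mul_one] at h2
  rw [← h3, h2, mul_comm]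

theorem exp_half (A : ℝ → ℝ) (hc : ContinuousOn A (Ici 0)) (hp : ∀ x, 0 ≤ x → 0 < A x)
    (ha : ∀ x, 0 ≤ x → ∀ y, 0 ≤ y → A (x + y) = A x * A y) :
    ∃ c : ℝ, ∀ x, 0 ≤ x → A x = Real.exp (c * x) := by
  obtain ⟨c, h⟩ := cauchy_half (fun x => Real.log (A x))
    (hc.log fun x hx => (hp x hx).ne') (by
      intro x hx y hy
      rw [ha x hx y hy, Real.log_mul (hp x hx).ne' (hp y hy).ne'])
  refine ⟨c, fun x hx => ?_⟩
  rw [← h x hx, Real.exp_log (hp x hx)]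

theorem solve_half (k : ℝ → ℝ) (hc : ContinuousOn k (Ici 0)) (hi : InjOn k (Ici 0))
    (k0 : k 0 = 0)
    (hT : ∀ b, 0 ≤ b → ∀ c, 0 ≤ c → ∀ y, 0 ≤ y →
      (k (b + y) - k y) * k c = (k (c + y) - k y) * k b) :
    (∃ κ : ℝ, κ ≠ 0 ∧ ∀ x, 0 ≤ x → k x = κ * x) ∨
    (∃ κ μ : ℝ, μ ≠ 0 ∧ ∀ x, 0 ≤ x → κ * k x = Real.exp (μ * x) - 1) := by
  have k1 : k 1 ≠ 0 := by
    intro h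
    have := hi (show (1:ℝ) ∈ Ici 0 by simp) (show (0:ℝ) ∈ Ici 0 by simp) (by rw [h, k0])
    norm_num at this
  obtain ⟨A, hA⟩ : ∃ A : ℝ → ℝ, ∀ y, A y = (k (1 + y) - k y) / k 1 := ⟨_, fun y => rfl⟩
  have e1 : ∀ b, 0 ≤ b → ∀ y, 0 ≤ y → k (b + y) = k y + A y * k b := by
    intro b hb y hy
    have := hT b hb 1 zero_le_one y hy
    rw [hA]; field_simp; linarith
  obtain ⟨κ, hκ⟩ : ∃ κ, κ = (A 1 - 1) / k 1 := ⟨_, rfl⟩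
  have e2 : ∀ t, 0 ≤ t → A t = 1 + κ * k t := by
    intro t ht
    have a1 := e1 t ht 1 zero_le_one
    have a2 := e1 1 zero_le_one t ht
    rw [add_comm 1 t] at a2
    rw [hκ]; field_simp; linarith
  by_cases hz : κ = 0
  · left
    obtain ⟨c, h⟩ := cauchy_half k hc (by
      intro x hx y hy
      rw [e1 x hx y hy, e2 y hy, hz]; ring)
    refine ⟨c, ?_, h⟩
    rintro rfl
    exact k1 (by rw [h 1 zero_le_one]; ring)
  · right
    have hm : ∀ x, 0 ≤ x → ∀ y, 0 ≤ y → A (x + y) = A x * A y := by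
      intro x hx y hy
      rw [e2 _ (add_nonneg hx hy), e1 x hx y hy, e2 x hx, e2 y hy]; ring
    have hne : ∀ x, 0 ≤ x → A x ≠ 0 := by
      intro x hx h
      have b1 := hm x hx 1 zero_le_one
      rw [h, zero_mul, e2 _ (by linarith)] at b1
      rw [e2 x hx] at h
      have : k (x + 1) = k x := mul_left_cancel₀ hz (by linarith)
      have := hi (show x + 1 ∈ Ici 0 by simp; linarith) (show x ∈ Ici 0 from hx) this
      linarith
    have hp : ∀ x, 0 ≤ x → 0 < A x := by
      intro x hx
      have b := hm (x/2) (by linarith) (x/2) (by linarith)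
      rw [add_halves] at b
      rw [b]
      exact mul_self_pos.2 (hne _ (by linarith))
    have hAc : ContinuousOn A (Ici 0) := by
      have : ContinuousOn (fun t => 1 + κ * k t) (Ici 0) := by fun_prop
      exact this.congr fun t ht => e2 t ht
    obtain ⟨μ, h⟩ := exp_half A hAc hp hm
    refine ⟨κ, μ, ?_, fun x hx => ?_⟩
    · rintro rfl
      have b := h 1 zero_le_one
      rw [e2 1 zero_le_one] at b
      simp [hz, k1] at b
    · rw [← h x hx, e2 x hx]; ring

theorem sum_prodDist {n m : ℕ} (U P : Fin n → ℝ) (V Q : Fin m → ℝ) (g : ℝ → ℝ) :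
    ∑ i, prodDist U V i * g (prodDist P Q i) = ∑ i, ∑ j, U i * V j * g (P i * Q j) := by
  unfold prodDist
  rw [finProdFinEquiv.symm.sum_comp (fun z : Fin n × Fin m => U z.1 * V z.2 * g (P z.1 * Q z.2)),
    Fintype.sum_prod_type]

/-- characterization of multiplicative (polynomially composable)
certainty measures satisfying axioms [C1]–[C3], equation (31) of the paper. -/
theorem multiplicative_certainty_characterization (e : ℝ) (he : 0 < e)
    (f finv : ℝ → ℝ)
    (hfc : ContinuousOn f (Ioi (0:ℝ)))
    (hfm : StrictMonoOn f (Ioi (0:ℝ)) ∨ StrictAntiOn f (Ioi (0:ℝ)))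
    (hfi : ∀ x ∈ Ioi (0:ℝ), finv (f x) = x)
    (CC : ℝ → ℝ)
    (hCCc : ContinuousOn CC (Ioc (0:ℝ) 1)) (hCCm : StrictMonoOn CC (Ioc (0:ℝ) 1))
    (hCCpos : ∀ p ∈ Ioc (0:ℝ) 1, 0 < CC p)
    (hCCmul : ∀ p ∈ Ioc (0:ℝ) 1, ∀ q ∈ Ioc (0:ℝ) 1,
      CC (p * q) = e * CC p * CC q)
    (C : ∀ n : ℕ, (Fin n → ℝ) → (Fin n → ℝ) → ℝ)
    (hCdef : ∀ (n : ℕ) (U P : Fin n → ℝ),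
      C n U P = finv (∑ k, U k * f (CC (P k))))
    (hmul : ∀ (n m : ℕ) (U : Fin n → ℝ) (V : Fin m → ℝ) (P : Fin n → ℝ)
      (Q : Fin m → ℝ), IsDist U → IsDist V → IsPosDist P → IsPosDist Q →
      C (n * m) (prodDist U V) (prodDist P Q) = e * C n U P * C m V Q) :
    ∃ τ : ℝ, τ < 0 ∧ ∃ c : ℝ, 0 < c * e ∧
      ((∀ (n : ℕ) (U P : Fin n → ℝ), IsDist U → IsPosDist P →
        C n U P =
          (1 / e) * (2:ℝ) ^ (-(c * τ * ∑ k, U k * Real.logb 2 (P k)))) ∨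
      (∃ lam : ℝ, lam ≠ 0 ∧ ∀ (n : ℕ) (U P : Fin n → ℝ), IsDist U → IsPosDist P →
        C n U P =
          (1 / e) * (∑ k, U k * P k ^ (τ * lam)) ^ (-(c / lam)))) := by
  obtain ⟨h, hh⟩ : ∃ h : ℝ → ℝ, ∀ x, h x = f (CC (Real.exp (-x))) := ⟨_, fun _ => rfl⟩
  have hE : ∀ x : ℝ, 0 ≤ x → Real.exp (-x) ∈ Ioc (0:ℝ) 1 := fun x hx =>
    ⟨Real.exp_pos _, by simpa using hx⟩
  have hinj : InjOn h (Ici 0) := by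
    intro x hx y hy hxy
    rw [hh, hh] at hxy
    have h1 : CC (Real.exp (-x)) = CC (Real.exp (-y)) := by
      rw [← hfi _ (hCCpos _ (hE x hx)), hxy, hfi _ (hCCpos _ (hE y hy))]
    have h2 := hCCm.injOn (hE x hx) (hE y hy) h1
    have := Real.exp_injective h2
    linarith
  have hcontE : ContinuousOn (fun x => CC (Real.exp (-x))) (Ici 0) :=
    hCCc.comp (f := fun x : ℝ => Real.exp (-x)) (by fun_prop) (fun x hx => hE x hx)
  have hcont : ContinuousOn h (Ici 0) := by
    have : ContinuousOn (fun x => f (CC (Real.exp (-x)))) (Ici 0) :=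
      hfc.comp hcontE (fun x hx => hCCpos _ (hE x hx))
    exact this.congr fun x _ => hh x
  have hfinv : ∀ x, 0 ≤ x → finv (h x) = CC (Real.exp (-x)) := by
    intro x hx
    rw [hh, hfi _ (hCCpos _ (hE x hx))]
  have hmon : StrictMonoOn h (Ici 0) ∨ StrictAntiOn h (Ici 0) := by
    rcases hfm with hf | hf
    · right
      intro x hx y hy hxy
      rw [hh, hh]
      exact hf (hCCpos _ (hE y hy)) (hCCpos _ (hE x hx))
        (hCCm (hE y hy) (hE x hx) (Real.exp_lt_exp.2 (by linarith)))
    · left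
      intro x hx y hy hxy
      rw [hh, hh]
      exact hf (hCCpos _ (hE y hy)) (hCCpos _ (hE x hx))
        (hCCm (hE y hy) (hE x hx) (Real.exp_lt_exp.2 (by linarith)))
  have hconv : Convex ℝ (h '' Ici 0) :=
    ((isPreconnected_Ici.image h hcont).ordConnected).convex
  have hCC1 : ∃ α : ℝ, 0 < α ∧ ∀ x, 0 ≤ x → CC (Real.exp (-x)) = (1/e) * Real.exp (-(α * x)) := by
    obtain ⟨c, hc⟩ := exp_half (fun x => e * CC (Real.exp (-x)))
      (continuousOn_const.mul hcontE)
      (fun x hx => mul_pos he (hCCpos _ (hE x hx))) (by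
        intro x hx y hy
        rw [neg_add, Real.exp_add, hCCmul _ (hE x hx) _ (hE y hy)]; ring)
    refine ⟨-c, ?_, fun x hx => ?_⟩
    · have c0 := hc 0 le_rfl
      have c1 := hc 1 zero_le_one
      have hlt := hCCm (hE 1 zero_le_one) (hE 0 le_rfl) (Real.exp_lt_exp.2 (by norm_num))
      have := mul_lt_mul_of_pos_left hlt he
      rw [c0, c1] at this
      have := Real.exp_lt_exp.1 this
      linarith
    · have := hc x hx
      rw [neg_mul, neg_neg, ← this]; field_simp
  obtain ⟨α, hα, hCC⟩ := hCC1
  -- key translation property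
  have key : ∀ a, 0 < a → ∀ c, 0 < c → Real.exp (-a) + Real.exp (-c) < 1 → ∀ y, 0 < y →
      ∀ b, 0 ≤ b → ∀ u, 0 ≤ u → u ≤ 1 → h b = u * h a + (1 - u) * h c →
      h (b + y) = u * h (a + y) + (1 - u) * h (c + y) := by
    intro a ha c hc hac y hy b hb u hu0 hu1 hub
    have hy1 : Real.exp (-y) < 1 := by simpa using hy
    have H := hmul 3 2 ![u, 1 - u, 0] ![1, 0]
      ![Real.exp (-a), Real.exp (-c), 1 - Real.exp (-a) - Real.exp (-c)]
      ![Real.exp (-y), 1 - Real.exp (-y)]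
      ⟨by intro i; fin_cases i <;> simp [hu0, hu1], by simp [Fin.sum_univ_three]⟩
      ⟨by intro i; fin_cases i <;> simp, by simp⟩
      ⟨by intro i; fin_cases i <;> simp [Real.exp_pos]; linarith, by simp [Fin.sum_univ_three]⟩
      ⟨by intro i; fin_cases i <;> simp [Real.exp_pos, hy], by simp⟩
    rw [hCdef, hCdef, hCdef, sum_prodDist _ _ _ _ (fun t => f (CC t))] at H
    simp only [Fin.sum_univ_three, Fin.sum_univ_two, Matrix.cons_val_zero, Matrix.cons_val_one,
      Matrix.cons_val, mul_zero, zero_mul, add_zero, mul_one, one_mul, ← Real.exp_add,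
      ← neg_add, ← hh] at H
    rw [← hub, hfinv b hb, hfinv y hy.le, ← hCCmul _ (hE b hb) _ (hE y hy.le), ← Real.exp_add,
      ← neg_add] at H
    obtain ⟨z, hz, hz'⟩ := hconv (mem_image_of_mem h (show a + y ∈ Ici 0 by simp; linarith))
      (mem_image_of_mem h (show c + y ∈ Ici 0 by simp; linarith)) hu0
      (show 0 ≤ 1 - u by linarith) (by ring)
    simp only [smul_eq_mul] at hz'
    rw [← hz', hfinv z hz] at H
    have := hCCm.injOn (hE z hz) (hE (b + y) (by linarith)) H
    have := Real.exp_injective this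
    have hzb : z = b + y := by linarith
    rw [← hz', hzb]
  have T1 : ∀ a, 0 < a → ∀ b, a < b → ∀ c, b < c → Real.exp (-a) + Real.exp (-c) < 1 →
      ∀ y, 0 ≤ y →
      (h (b + y) - h (a + y)) * (h c - h a) = (h (c + y) - h (a + y)) * (h b - h a) := by
    intro a ha b hab c hbc hac y hy
    rcases hy.eq_or_lt with rfl | hy
    · simp only [add_zero]; ring
    have ma : a ∈ Ici (0:ℝ) := ha.le
    have mb : b ∈ Ici (0:ℝ) := (ha.trans hab).le
    have mc : c ∈ Ici (0:ℝ) := ((ha.trans hab).trans hbc).le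
    have hne : h c - h a ≠ 0 := by
      intro h0
      have := hinj mc ma (by linarith)
      linarith
    have hu : 0 ≤ (h c - h b) / (h c - h a) ∧ (h c - h b) / (h c - h a) ≤ 1 := by
      rcases hmon with hm | hm
      · have q1 := hm ma mb hab
        have q2 := hm mb mc hbc
        exact ⟨div_nonneg (by linarith) (by linarith), (div_le_one (by linarith)).2 (by linarith)⟩
      · have q1 := hm ma mb hab
        have q2 := hm mb mc hbc
        exact ⟨div_nonneg_of_nonpos (by linarith) (by linarith),
          (div_le_one_of_neg (by linarith)).2 (by linarith)⟩
    have := key a ha c (by linarith) hac y hy b mb _ hu.1 hu.2 (by field_simp; ring)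
    rw [this]; field_simp; ring
  have T2 : ∀ a, 0 < a → ∀ b, a < b → ∀ c, b < c → ∀ y, 0 ≤ y →
      (h (b + y) - h (a + y)) * (h c - h a) = (h (c + y) - h (a + y)) * (h b - h a) := by
    intro a ha b hab c hbc y hy
    obtain ⟨d, hcd, hd⟩ : ∃ d, c < d ∧ Real.exp (-a) + Real.exp (-d) < 1 := by
      have h1 : Real.exp (-a) < 1 := by simpa using ha
      refine ⟨max (c + 1) (1 - Real.log (1 - Real.exp (-a))), ?_, ?_⟩
      · exact lt_of_lt_of_le (by linarith) (le_max_left _ _)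
      · have h2 : Real.exp (-(max (c + 1) (1 - Real.log (1 - Real.exp (-a)))))
            < Real.exp (Real.log (1 - Real.exp (-a))) := by
          apply Real.exp_lt_exp.2
          have := le_max_right (c + 1) (1 - Real.log (1 - Real.exp (-a)))
          linarith
        rw [Real.exp_log (by linarith)] at h2
        linarith
    have t1 := T1 a ha b hab d (hbc.trans hcd) hd y hy
    have t2 := T1 a ha c (hab.trans hbc) d hcd hd y hy
    have hne : h d - h a ≠ 0 := by
      intro h0
      have := hinj (show d ∈ Ici (0:ℝ) by simp; linarith) (show a ∈ Ici (0:ℝ) from ha.le)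
        (by linarith)
      linarith
    apply mul_left_cancel₀ hne
    linear_combination (h c - h a) * t1 - (h b - h a) * t2
  have T3 : ∀ b, 0 < b → ∀ c, b < c → ∀ y, 0 ≤ y →
      (h (b + y) - h y) * (h c - h 0) = (h (c + y) - h y) * (h b - h 0) := by
    intro b hb c hbc y hy
    have l0 : Filter.Tendsto h (nhdsWithin 0 (Ioi 0)) (nhds (h 0)) :=
      (hcont 0 (by simp)).mono_left (nhdsWithin_mono _ Ioi_subset_Ici_self)
    have ly : Filter.Tendsto (fun a => h (a + y)) (nhdsWithin 0 (Ioi 0)) (nhds (h y)) := by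
      have : ContinuousOn (fun a => h (a + y)) (Ici 0) :=
        hcont.comp (f := fun a : ℝ => a + y) (by fun_prop) (fun x hx => add_nonneg hx hy)
      have := (this 0 (by simp)).mono_left (nhdsWithin_mono _ Ioi_subset_Ici_self)
      simpa using this
    have L := (ly.const_sub (h (b + y))).mul (l0.const_sub (h c))
    have R := (ly.const_sub (h (c + y))).mul (l0.const_sub (h b))
    refine tendsto_nhds_unique_of_eventuallyEq L R ?_
    filter_upwards [Ioo_mem_nhdsGT hb] with a ha
    exact T2 a ha.1 b ha.2 c hbc y hy
  have T4 : ∀ b, 0 ≤ b → ∀ c, 0 ≤ c → ∀ y, 0 ≤ y →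
      (h (b + y) - h 0 - (h y - h 0)) * (h c - h 0)
        = (h (c + y) - h 0 - (h y - h 0)) * (h b - h 0) := by
    intro b hb c hc y hy
    rcases hb.eq_or_lt with rfl | hb
    · simp
    rcases hc.eq_or_lt with rfl | hc
    · simp
    rcases lt_trichotomy b c with hbc | rfl | hbc
    · linear_combination T3 b hb c hbc y hy
    · rfl
    · linear_combination -T3 c hc b hbc y hy
  have S := solve_half (fun x => h x - h 0) (hcont.sub continuousOn_const)
    (fun x hx y hy hxy => hinj hx hy (by simpa using hxy)) (by simp) T4
  -- representation of C
  have rep : ∀ (n : ℕ) (U P : Fin n → ℝ), IsDist U → IsPosDist P →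
      (∀ k, 0 ≤ -Real.log (P k)) ∧ ∃ z, 0 ≤ z ∧ C n U P = (1/e) * Real.exp (-(α * z)) ∧
        h z - h 0 = ∑ k, U k * (h (-Real.log (P k)) - h 0) := by
    intro n U P hU hP
    have hle : ∀ k, P k ≤ 1 := fun k => by
      rw [← hP.2]
      exact Finset.single_le_sum (fun i _ => (hP.1 i).le) (Finset.mem_univ k)
    have hx : ∀ k, 0 ≤ -Real.log (P k) := fun k => by
      have := Real.log_nonpos (hP.1 k).le (hle k)
      linarith
    refine ⟨hx, ?_⟩
    obtain ⟨z, hz, hz'⟩ := hconv.sum_mem (t := Finset.univ) (w := U)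
      (z := fun k => h (-Real.log (P k))) (fun i _ => hU.1 i) hU.2
      (fun i _ => mem_image_of_mem h (hx i))
    simp only [smul_eq_mul] at hz'
    refine ⟨z, hz, ?_, ?_⟩
    · rw [hCdef, ← hCC z hz, ← hfinv z hz, hz']
      congr 1
      refine Finset.sum_congr rfl fun k _ => ?_
      rw [hh, neg_neg, Real.exp_log (hP.1 k)]
    · simp only [mul_sub, Finset.sum_sub_distrib, ← Finset.sum_mul]
      rw [hU.2, hz', one_mul]
  refine ⟨-1, by norm_num, α, mul_pos hα he, ?_⟩
  rcases S with ⟨κ, hκ, hS⟩ | ⟨κ, μ, hμ, hS⟩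
  · left
    intro n U P hU hP
    obtain ⟨hx, z, hz, hCz, hsum⟩ := rep n U P hU hP
    have hz2 : z = -∑ k, U k * Real.log (P k) := by
      apply mul_left_cancel₀ hκ
      rw [← hS z hz, hsum, ← Finset.sum_neg_distrib, Finset.mul_sum]
      refine Finset.sum_congr rfl fun k _ => ?_
      rw [hS _ (hx k)]; ring
    have hl2 : Real.log 2 ≠ 0 := (Real.log_pos (by norm_num)).ne'
    have hlb : Real.log 2 * ∑ k, U k * Real.logb 2 (P k) = ∑ k, U k * Real.log (P k) := by
      rw [Finset.mul_sum]
      refine Finset.sum_congr rfl fun k _ => ?_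
      unfold Real.logb; field_simp
    rw [hCz, Real.rpow_def_of_pos (by norm_num), hz2, ← hlb]
    congr 2; ring
  · right
    refine ⟨μ, hμ, fun n U P hU hP => ?_⟩
    obtain ⟨hx, z, hz, hCz, hsum⟩ := rep n U P hU hP
    have hz2 : Real.exp (μ * z) = ∑ k, U k * P k ^ (-1 * μ) := by
      have h1 : Real.exp (μ * z) - 1 = ∑ k, U k * (P k ^ (-1 * μ) - 1) := by
        rw [← hS z hz, hsum, Finset.mul_sum]
        refine Finset.sum_congr rfl fun k _ => ?_
        rw [mul_left_comm, hS _ (hx k), Real.rpow_def_of_pos (hP.1 k)]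
        congr 3; ring
      simp only [mul_sub, Finset.sum_sub_distrib, mul_one, hU.2] at h1
      linarith
    rw [hCz, ← hz2, ← Real.exp_mul]
    congr 2; field_simp
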